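/- Let n ≥ 1, 1 ≤ p < ∞, 0 < T < ∞, and let (φ′,ψ′) be a Littlewood–Paley family on ℝⁿ. There exists C > 0 (depending only on n, p, T, φ′, ψ′) such that for every Schwartz function f on ℝⁿ, the heat extension u(X,t) = (Γ(·,t)*f)(X) satisfies ( ∫_0^T ∫_{ℝⁿ} |u(X,t)|^p dX dt )^{1/p} ≤ C·B_{−2/p, p}(f). -/

import Mathlib

noncomputable section

open MeasureTheory Real Complex
open scoped ENNReal NNReal Real BigOperators

/-- Euclidean space `ℝⁿ`. -/
abbrev Rn (n : ℕ) : Type := EuclideanSpace ℝ (Fin n)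

/-- The space `ℝ^{n+1} = ℝⁿ × ℝ`, points written `(X, t)`. -/
abbrev Rn1 (n : ℕ) : Type := EuclideanSpace ℝ (Fin n) × ℝ

/-- Fourier transform on `ℝ^{n+1}`:
`𝓕f(ξ,τ) = ∫ e^{−2πi(X·ξ + tτ)} f(X,t) dX dt`. -/
def FT1 {n : ℕ} (f : Rn1 n → ℂ) (q : Rn1 n) : ℂ :=
  ∫ p : Rn1 n,
    Complex.exp (-(2 * (π : ℂ) * Complex.I) *
      (((∑ k, p.1 k * q.1 k) + p.2 * q.2 : ℝ) : ℂ)) * f p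

/-- Inverse Fourier transform on `ℝ^{n+1}`. -/
def IFT1 {n : ℕ} (f : Rn1 n → ℂ) (x : Rn1 n) : ℂ :=
  ∫ q : Rn1 n,
    Complex.exp ((2 * (π : ℂ) * Complex.I) *
      (((∑ k, q.1 k * x.1 k) + q.2 * x.2 : ℝ) : ℂ)) * f q

/-- The Fourier multiplier operator `f ↦ 𝓕⁻¹(m · 𝓕 f)` on `ℝ^{n+1}`. -/
def MOp {n : ℕ} (m : Rn1 n → ℂ) (f : Rn1 n → ℂ) : Rn1 n → ℂ :=
  IFT1 (fun q => m q * FT1 f q)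

/-- The symbol `m_α(ξ,τ) = (1 + 4π²|ξ|² + iτ)^{α/2}` (principal branch). -/
def mSym {n : ℕ} (α : ℝ) (q : Rn1 n) : ℂ :=
  (1 + 4 * (π : ℂ) ^ 2 * (‖q.1‖ : ℂ) ^ 2 + Complex.I * (q.2 : ℂ)) ^ ((α : ℂ) / 2)

/-- Partial derivative `∂_{X_k}`. -/
def dX {n : ℕ} (k : Fin n) (f : Rn1 n → ℂ) : Rn1 n → ℂ :=
  fun x => fderiv ℝ f x (EuclideanSpace.single k 1, 0)

/-- Partial derivative `∂_t`. -/
def dT {n : ℕ} (f : Rn1 n → ℂ) : Rn1 n → ℂ :=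
  fun x => fderiv ℝ f x (0, 1)

/-- Iterated spatial derivative `D_X^β` for a multi-index `β`. -/
def dXmulti {n : ℕ} (β : Fin n → ℕ) (f : Rn1 n → ℂ) : Rn1 n → ℂ :=
  (List.finRange n).foldr (fun k g => (dX k)^[β k] g) f

/-- The half time-derivative `D_t^{1/2} f = 𝓕⁻¹(|τ|^{1/2}·𝓕f)`. -/
def halfDt {n : ℕ} (f : Rn1 n → ℂ) : Rn1 n → ℂ :=
  MOp (fun q => ((|q.2| ^ ((1 : ℝ) / 2) : ℝ) : ℂ)) f

/-- The `Lᵖ(ℝ^{n+1})` norm (as a value in `ℝ≥0∞`), `p` a real exponent. -/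
def pNorm {n : ℕ} (p : ℝ) (f : Rn1 n → ℂ) : ℝ≥0∞ :=
  eLpNorm f (ENNReal.ofReal p) volume

/-- Multi-indices `β ∈ ℕⁿ` with `|β| = N`. -/
def multiIdx (n N : ℕ) : Finset (Fin n → ℕ) :=
  (Fintype.piFinset fun _ : Fin n => Finset.range (N + 1)).filter fun β => (∑ k, β k) = N

/-- Convolution on `ℝ^{n+1}`. -/
def conv1 {n : ℕ} (g f : Rn1 n → ℂ) : Rn1 n → ℂ :=
  fun x => ∫ y : Rn1 n, g (x - y) * f y

/-- A parabolic Littlewood–Paley family on `ℝ^{n+1}`. -/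
structure ParabolicLP (n : ℕ) where
  φ : SchwartzMap (Rn1 n) ℂ
  ψ : SchwartzMap (Rn1 n) ℂ
  ft_pos : ∀ q : Rn1 n,
    1 / 2 < ‖q.1‖ + |q.2| ^ ((1 : ℝ) / 2) → ‖q.1‖ + |q.2| ^ ((1 : ℝ) / 2) < 2 →
      0 < (FT1 (⇑φ) q).re ∧ (FT1 (⇑φ) q).im = 0
  ft_supp : ∀ q : Rn1 n,
    ¬(1 / 2 < ‖q.1‖ + |q.2| ^ ((1 : ℝ) / 2) ∧ ‖q.1‖ + |q.2| ^ ((1 : ℝ) / 2) < 2) →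
      FT1 (⇑φ) q = 0
  ft_sum : ∀ q : Rn1 n, q ≠ 0 →
    ∑' i : ℤ, FT1 (⇑φ) (((2 : ℝ) ^ (-i)) • q.1, ((2 : ℝ) ^ (-(2 * i))) * q.2) = 1
  ft_psi : ∀ q : Rn1 n,
    FT1 (⇑ψ) q =
      1 - ∑' i : ℕ,
        FT1 (⇑φ) (((2 : ℝ) ^ (-((i : ℤ) + 1))) • q.1, ((2 : ℝ) ^ (-(2 * ((i : ℤ) + 1)))) * q.2)

/-- The dilate `φ_i`, whose Fourier transform is `𝓕φ(2^{−i}ξ, 2^{−2i}τ)`. -/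
def lpPhi {n : ℕ} (P : ParabolicLP n) (i : ℕ) : Rn1 n → ℂ :=
  fun x => (((2 : ℝ) ^ (i * (n + 2)) : ℝ) : ℂ) *
    P.φ (((2 : ℝ) ^ i) • x.1, ((2 : ℝ) ^ (2 * i)) * x.2)

/-- Parabolic Besov norm `N_{s,p}(f)` on `ℝ^{n+1}`, `1 ≤ p < ∞`. -/
def pBesov {n : ℕ} (P : ParabolicLP n) (s p : ℝ) (f : Rn1 n → ℂ) : ℝ≥0∞ :=
  eLpNorm (conv1 (⇑P.ψ) f) (ENNReal.ofReal p) volume +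
  (∑' i : ℕ,
    (ENNReal.ofReal ((2 : ℝ) ^ (s * ((i : ℝ) + 1))) *
      eLpNorm (conv1 (lpPhi P (i + 1)) f) (ENNReal.ofReal p) volume) ^ p) ^ (1 / p)

/-- Parabolic Besov norm `N_{s,∞}(f)` on `ℝ^{n+1}`. -/
def pBesovInf {n : ℕ} (P : ParabolicLP n) (s : ℝ) (f : Rn1 n → ℂ) : ℝ≥0∞ :=
  max (eLpNorm (conv1 (⇑P.ψ) f) ⊤ volume)
    (⨆ i : ℕ, ENNReal.ofReal ((2 : ℝ) ^ (s * ((i : ℝ) + 1))) *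
      eLpNorm (conv1 (lpPhi P (i + 1)) f) ⊤ volume)

/-- The time interval `(0, T)` for `0 < T ≤ ∞`. -/
def tSet (T : ℝ≥0∞) : Set ℝ := {t : ℝ | 0 < t ∧ ENNReal.ofReal t < T}

/-- Lebesgue measure restricted to the strip `ℝⁿ × (0,T)`. -/
def stripMeasure (n : ℕ) (T : ℝ≥0∞) : Measure (Rn1 n) :=
  volume.restrict {x : Rn1 n | x.2 ∈ tSet T}

/-- The parabolic Sobolev norm `‖g‖_{W^{2i,i}_p(ℝⁿ_T)}`. -/
def wNorm {n : ℕ} (i : ℕ) (p : ℝ) (T : ℝ≥0∞) (g : Rn1 n → ℂ) : ℝ≥0∞ :=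
  ∑ l ∈ Finset.range (i + 1),
    ∑ β ∈ (Fintype.piFinset fun _ : Fin n => Finset.range (2 * i + 1)).filter
        (fun β => (∑ k, β k) + 2 * l ≤ 2 * i),
      eLpNorm (dXmulti β (dT^[l] g)) (ENNReal.ofReal p) (stripMeasure n T)

/-- Time-regularity seminorm `[g]_{t,β,p,T}`. -/
def semT {n : ℕ} (b p : ℝ) (T : ℝ≥0∞) (g : Rn1 n → ℂ) : ℝ≥0∞ :=
  (∫⁻ X : Rn n, ∫⁻ t in tSet T, ∫⁻ s in tSet T,
      ENNReal.ofReal (‖g (X, t) - g (X, s)‖ ^ p / |t - s| ^ (1 + p * b / 2))) ^ (1 / p)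

/-- Space-regularity seminorm `[g]_{x,β,p,T}`. -/
def semX {n : ℕ} (b p : ℝ) (T : ℝ≥0∞) (g : Rn1 n → ℂ) : ℝ≥0∞ :=
  (∫⁻ t in tSet T, ∫⁻ X : Rn n, ∫⁻ Y : Rn n,
      ENNReal.ofReal (‖g (X + Y, t) - 2 * g (X, t) + g (X - Y, t)‖ ^ p /
        ‖Y‖ ^ ((n : ℝ) + p * b))) ^ (1 / p)

/-- The parabolic Besov norm `‖g‖_{B^{α,α/2}_p(ℝⁿ_T)}`, formed with index `i` where
`2i < α < 2i+2`. -/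
def pbNorm {n : ℕ} (i : ℕ) (α p : ℝ) (T : ℝ≥0∞) (g : Rn1 n → ℂ) : ℝ≥0∞ :=
  wNorm i p T g +
  ∑ l ∈ Finset.range (i + 1),
    ∑ β ∈ (Fintype.piFinset fun _ : Fin n => Finset.range (2 * i + 1)).filter
        (fun β => (∑ k, β k) + 2 * l = 2 * i),
      (semT (α - 2 * i) p T (dXmulti β (dT^[l] g)) +
        semX (α - 2 * i) p T (dXmulti β (dT^[l] g)))

/-- Fourier transform on `ℝⁿ`. -/
def FTn {n : ℕ} (f : Rn n → ℂ) (ξ : Rn n) : ℂ :=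
  ∫ x : Rn n, Complex.exp (-(2 * (π : ℂ) * Complex.I) * (((∑ k, x k * ξ k : ℝ)) : ℂ)) * f x

/-- Inverse Fourier transform on `ℝⁿ`. -/
def IFTn {n : ℕ} (f : Rn n → ℂ) (x : Rn n) : ℂ :=
  ∫ ξ : Rn n, Complex.exp ((2 * (π : ℂ) * Complex.I) * (((∑ k, ξ k * x k : ℝ)) : ℂ)) * f ξ

/-- Convolution on `ℝⁿ`. -/
def convn {n : ℕ} (g f : Rn n → ℂ) : Rn n → ℂ := fun x => ∫ y : Rn n, g (x - y) * f y

/-- A Littlewood–Paley family on `ℝⁿ`. -/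
structure LPFamily (n : ℕ) where
  φ : SchwartzMap (Rn n) ℂ
  ψ : SchwartzMap (Rn n) ℂ
  ft_pos : ∀ ξ : Rn n, 1 / 2 < ‖ξ‖ → ‖ξ‖ < 2 →
    0 < (FTn (⇑φ) ξ).re ∧ (FTn (⇑φ) ξ).im = 0
  ft_supp : ∀ ξ : Rn n, ¬(1 / 2 < ‖ξ‖ ∧ ‖ξ‖ < 2) → FTn (⇑φ) ξ = 0
  ft_sum : ∀ ξ : Rn n, ξ ≠ 0 → ∑' i : ℤ, FTn (⇑φ) (((2 : ℝ) ^ (-i)) • ξ) = 1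
  ft_psi : ∀ ξ : Rn n,
    FTn (⇑ψ) ξ = 1 - ∑' i : ℕ, FTn (⇑φ) (((2 : ℝ) ^ (-((i : ℤ) + 1))) • ξ)

/-- The dilate `φ′_i(x) = 2^{in} φ′(2^i x)`. -/
def lpPhin {n : ℕ} (P : LPFamily n) (i : ℕ) : Rn n → ℂ :=
  fun x => (((2 : ℝ) ^ (i * n) : ℝ) : ℂ) * P.φ (((2 : ℝ) ^ i) • x)

/-- Besov norm `B_{s,p}(f)` on `ℝⁿ`, `1 ≤ p < ∞`. -/
def besovN {n : ℕ} (P : LPFamily n) (s p : ℝ) (f : Rn n → ℂ) : ℝ≥0∞ :=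
  eLpNorm (convn (⇑P.ψ) f) (ENNReal.ofReal p) volume +
  (∑' i : ℕ,
    (ENNReal.ofReal ((2 : ℝ) ^ (s * ((i : ℝ) + 1))) *
      eLpNorm (convn (lpPhin P (i + 1)) f) (ENNReal.ofReal p) volume) ^ p) ^ (1 / p)

/-- The heat kernel `Γ(X,t)` on `ℝⁿ` (zero for `t ≤ 0`). -/
def heatKer (n : ℕ) (X : Rn n) (t : ℝ) : ℝ :=
  if 0 < t then (4 * π * t) ^ (-(n : ℝ) / 2) * Real.exp (-‖X‖ ^ 2 / (4 * t)) else 0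

/-- The heat extension `u(X,t) = ∫ Γ(X−Y,t) f(Y) dY`. -/
def heatExt {n : ℕ} (f : Rn n → ℂ) : Rn1 n → ℂ :=
  fun x => ∫ Y : Rn n, (heatKer n (x.1 - Y) x.2 : ℂ) * f Y

/-- Weighted Jensen inequality for `ℝ≥0∞`-valued functions. -/
theorem lintegral_mul_rpow_le {α : Type*} [MeasurableSpace α] (μ : Measure α) {p : ℝ}
    (hp : 1 ≤ p) {w c : α → ℝ≥0∞} (hw : Measurable w) (hc : Measurable c) :
    (∫⁻ x, w x * c x ∂μ) ^ p ≤ (∫⁻ x, w x ∂μ) ^ (p - 1) * ∫⁻ x, w x * c x ^ p ∂μ := by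
  have hp0 : 0 < p := by linarith
  have h := eLpNorm'_le_eLpNorm'_mul_rpow_measure_univ (μ := μ.withDensity w) (f := c)
    one_pos hp hc.aestronglyMeasurable
  simp only [eLpNorm', enorm_eq_self, ENNReal.rpow_one, div_one] at h
  rw [lintegral_withDensity_eq_lintegral_mul _ hw hc,
    lintegral_withDensity_eq_lintegral_mul _ hw (hc.pow_const p),
    withDensity_apply _ MeasurableSet.univ, Measure.restrict_univ] at h
  have h2 := ENNReal.rpow_le_rpow h hp0.le
  rw [ENNReal.mul_rpow_of_nonneg _ _ hp0.le, ← ENNReal.rpow_mul, ← ENNReal.rpow_mul,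
    one_div_mul_cancel hp0.ne', ENNReal.rpow_one, sub_mul, one_mul,
    one_div_mul_cancel hp0.ne'] at h2
  rw [mul_comm]
  exact h2

/-- Young's inequality `L¹ * Lᵖ → Lᵖ` for `ℝ≥0∞`-valued functions. -/
theorem lintegral_conv_rpow_le {n : ℕ} {p : ℝ} (hp : 1 ≤ p) {k g : Rn n → ℝ≥0∞}
    (hk : Measurable k) (hg : Measurable g) :
    ∫⁻ x, (∫⁻ y, k y * g (x - y)) ^ p ≤ (∫⁻ y, k y) ^ p * ∫⁻ y, g y ^ p := by
  have hp1 : 0 ≤ p - 1 := by linarith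
  calc ∫⁻ x, (∫⁻ y, k y * g (x - y)) ^ p
      ≤ ∫⁻ x, (∫⁻ y, k y) ^ (p - 1) * ∫⁻ y, k y * g (x - y) ^ p :=
        lintegral_mono fun x => lintegral_mul_rpow_le _ hp hk
          (hg.comp (measurable_const.sub measurable_id))
    _ = (∫⁻ y, k y) ^ (p - 1) * ∫⁻ x, ∫⁻ y, k y * g (x - y) ^ p := by
        rw [lintegral_const_mul]
        exact Measurable.lintegral_prod_right (by fun_prop)
    _ = (∫⁻ y, k y) ^ (p - 1) * ∫⁻ y, ∫⁻ x, k y * g (x - y) ^ p := by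
        rw [lintegral_lintegral_swap]
        exact Measurable.aemeasurable (by fun_prop)
    _ = (∫⁻ y, k y) ^ (p - 1) * ((∫⁻ y, k y) * ∫⁻ y, g y ^ p) := by
        congr 1
        rw [← lintegral_mul_const _ hk]
        refine lintegral_congr fun y => ?_
        rw [lintegral_const_mul _ (by fun_prop), lintegral_sub_right_eq_self (fun x => g x ^ p) y]
    _ = _ := by
        rw [← mul_assoc]
        nth_rw 2 [← ENNReal.rpow_one (∫⁻ y, k y)]
        rw [← ENNReal.rpow_add_of_nonneg _ _ hp1 zero_le_one, sub_add_cancel]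

theorem eLpNorm_ofReal_rpow {α : Type*} [MeasurableSpace α] (μ : Measure α) {p : ℝ}
    (hp : 1 ≤ p) (f : α → ℂ) :
    eLpNorm f (ENNReal.ofReal p) μ ^ p = ∫⁻ x, ‖f x‖ₑ ^ p ∂μ := by
  have hp0 : 0 < p := by linarith
  rw [eLpNorm_eq_lintegral_rpow_enorm_toReal (by simpa using hp0) ENNReal.ofReal_ne_top,
    ENNReal.toReal_ofReal hp0.le, ← ENNReal.rpow_mul, one_div_mul_cancel hp0.ne',
    ENNReal.rpow_one]

theorem eLpNorm_conv_le {n : ℕ} {p : ℝ} (hp : 1 ≤ p) {k g : Rn n → ℂ}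
    (hk : Measurable k) (hg : Measurable g) :
    eLpNorm (fun x => ∫ y, k y * g (x - y)) (ENNReal.ofReal p) volume ≤
      eLpNorm k 1 volume * eLpNorm g (ENNReal.ofReal p) volume := by
  have hp0 : 0 < p := by linarith
  rw [← ENNReal.rpow_le_rpow_iff hp0, ENNReal.mul_rpow_of_nonneg _ _ hp0.le,
    eLpNorm_ofReal_rpow _ hp, eLpNorm_ofReal_rpow _ hp, eLpNorm_one_eq_lintegral_enorm]
  refine le_trans (lintegral_mono fun x => ?_)
    (lintegral_conv_rpow_le hp hk.enorm hg.enorm)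
  refine ENNReal.rpow_le_rpow (le_trans (enorm_integral_le_lintegral_enorm _) ?_) hp0.le
  exact lintegral_mono fun y => (enorm_mul _ _).le

/-- The decay profile `min(1, x⁻²)`. -/
def decayProfile (x : ℝ) : ℝ := min 1 (x ^ (-2 : ℝ))

theorem decayProfile_nonneg {x : ℝ} (hx : 0 ≤ x) : 0 ≤ decayProfile x :=
  le_min zero_le_one (Real.rpow_nonneg hx _)

@[fun_prop]
theorem measurable_decayProfile : Measurable decayProfile :=
  measurable_const.min (measurable_id.pow_const _)

theorem lintegral_comp_smul {n : ℕ} {f : Rn n → ℝ≥0∞} (hf : Measurable f) {c : ℝ} (hc : 0 < c) :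
    ∫⁻ x, f (c • x) = ENNReal.ofReal ((c ^ n)⁻¹) * ∫⁻ x, f x := by
  rw [← lintegral_map hf (measurable_const_smul c), Measure.map_addHaar_smul _ hc.ne',
    lintegral_smul_measure, finrank_euclideanSpace, Fintype.card_fin,
    abs_of_pos (by positivity), smul_eq_mul]

theorem lintegral_Ioi_comp_mul {f : ℝ → ℝ≥0∞} (hf : Measurable f) {c : ℝ} (hc : 0 < c) :
    ∫⁻ x in Set.Ioi 0, f (c * x) = ENNReal.ofReal c⁻¹ * ∫⁻ x in Set.Ioi 0, f x := by
  rw [← lintegral_indicator measurableSet_Ioi, ← lintegral_indicator measurableSet_Ioi]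
  have h : (Set.Ioi (0 : ℝ)).indicator (fun x => f (c * x)) =
      fun x => (Set.Ioi (0 : ℝ)).indicator f (c * x) := by
    ext x
    simp [Set.indicator, hc]
  rw [h, ← lintegral_map (hf.indicator measurableSet_Ioi) (measurable_const_mul c),
    Real.map_volume_mul_left hc.ne', lintegral_smul_measure,
    abs_of_pos (by positivity), smul_eq_mul]

theorem exists_tsum_decayProfile_le {δ : ℝ} (hδ : 0 < δ) (hδ2 : δ < 2) :
    ∃ C : ℝ≥0∞, C ≠ ⊤ ∧ ∀ t : ℝ, 0 < t →
      ∑' i : ℕ, ENNReal.ofReal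
        (decayProfile (t * 4 ^ (i + 1)) * (t * 4 ^ (i + 1)) ^ δ) ≤ C := by
  set q₁ : ℝ≥0∞ := ENNReal.ofReal ((4 : ℝ) ^ (δ - 2)) with hq₁
  set q₂ : ℝ≥0∞ := ENNReal.ofReal ((4 : ℝ) ^ (-δ)) with hq₂
  have h1 : q₁ < 1 := by
    rw [hq₁, ENNReal.ofReal_lt_one]
    exact Real.rpow_lt_one_of_one_lt_of_neg (by norm_num) (by linarith)
  have h2 : q₂ < 1 := by
    rw [hq₂, ENNReal.ofReal_lt_one]
    exact Real.rpow_lt_one_of_one_lt_of_neg (by norm_num) (by linarith)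
  refine ⟨(∑' j : ℕ, q₁ ^ j) + ∑' j : ℕ, q₂ ^ j, ?_, fun t ht => ?_⟩
  · rw [ENNReal.tsum_geometric, ENNReal.tsum_geometric]
    refine ENNReal.add_ne_top.2 ⟨ENNReal.inv_ne_top.2 ?_, ENNReal.inv_ne_top.2 ?_⟩
    · exact (tsub_pos_of_lt h1).ne'
    · exact (tsub_pos_of_lt h2).ne'
  obtain ⟨k, hk1, hk2⟩ := exists_mem_Ico_zpow ht (by norm_num : (1 : ℝ) < 4)
  set g : ℝ → ℝ≥0∞ := fun x => ENNReal.ofReal (decayProfile x * x ^ δ) with hg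
  have h4 : (0 : ℝ) < 4 ^ k := by positivity
  set r := t / 4 ^ k with hr
  have hr1 : 1 ≤ r := (one_le_div h4).2 hk1
  have hr2 : r < 4 := by
    rw [hr, div_lt_iff₀ h4]
    rwa [zpow_add₀ (by norm_num), zpow_one, mul_comm] at hk2
  have hr0 : 0 < r := by linarith
  have hinj : Function.Injective (fun i : ℕ => (i : ℤ) + 1 + k) := by
    intro a b hab
    simpa using hab
  have hle : ∑' i : ℕ, g (t * 4 ^ (i + 1)) ≤ ∑' j : ℤ, g (r * 4 ^ j) := by
    refine le_trans (le_of_eq ?_) (ENNReal.tsum_comp_le_tsum_of_injective hinj _)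
    refine tsum_congr fun i => ?_
    congr 1
    rw [zpow_add₀ (by norm_num), hr]
    field_simp
    norm_cast
  refine hle.trans ?_
  rw [(HasSum.of_nat_of_neg_add_one (f := fun j : ℤ => g (r * 4 ^ j))
    ENNReal.summable.hasSum ENNReal.summable.hasSum).tsum_eq]
  refine add_le_add (ENNReal.tsum_le_tsum fun j => ?_) (ENNReal.tsum_le_tsum fun j => ?_)
  · rw [hg, hq₁, ← ENNReal.ofReal_pow (by positivity)]
    refine ENNReal.ofReal_le_ofReal ?_
    have hx : 0 < r * 4 ^ (j : ℤ) := by positivity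
    calc decayProfile (r * 4 ^ (j : ℤ)) * (r * 4 ^ (j : ℤ)) ^ δ
        ≤ (r * 4 ^ (j : ℤ)) ^ (-2 : ℝ) * (r * 4 ^ (j : ℤ)) ^ δ := by
          gcongr
          exact min_le_right _ _
      _ = (r * 4 ^ (j : ℤ)) ^ (δ - 2) := by
          rw [← Real.rpow_add hx]
          congr 1
          ring
      _ ≤ (4 ^ j) ^ (δ - 2) := by
          refine Real.rpow_le_rpow_of_nonpos (by positivity) ?_ (by linarith)
          rw [zpow_natCast]
          exact le_mul_of_one_le_left (by positivity) hr1
      _ = _ := by rw [← Real.rpow_natCast, ← Real.rpow_natCast, ← Real.rpow_mul (by norm_num),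
                    ← Real.rpow_mul (by norm_num), mul_comm]
  · rw [hg, hq₂, ← ENNReal.ofReal_pow (by positivity)]
    refine ENNReal.ofReal_le_ofReal ?_
    have hx : 0 < r * 4 ^ (-((j : ℤ) + 1)) := by positivity
    calc decayProfile (r * 4 ^ (-((j : ℤ) + 1))) * (r * 4 ^ (-((j : ℤ) + 1))) ^ δ
        ≤ 1 * (r * 4 ^ (-((j : ℤ) + 1))) ^ δ := by
          gcongr
          exact min_le_left _ _
      _ ≤ ((4 ^ j)⁻¹) ^ δ := by
          rw [one_mul]
          refine Real.rpow_le_rpow hx.le ?_ hδ.le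
          rw [zpow_neg, zpow_add₀ (by norm_num), zpow_one, zpow_natCast, mul_inv, mul_comm,
            mul_assoc]
          refine mul_le_of_le_one_right (by positivity) ?_
          rw [inv_mul_le_iff₀ (by norm_num)]
          linarith
      _ = _ := by
          rw [← Real.rpow_natCast, ← Real.rpow_natCast, ← Real.rpow_neg (by norm_num),
            ← Real.rpow_mul (by norm_num), ← Real.rpow_mul (by norm_num)]
          congr 1
          ring

theorem lintegral_decayProfile_rpow_ne_top {e : ℝ} (he : -1 < e) (he' : e < 1) :
    ∫⁻ x in Set.Ioi 0, ENNReal.ofReal (decayProfile x * x ^ e) ≠ ⊤ := by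
  have h1 : IntegrableOn (fun x : ℝ => x ^ e) (Set.Ioc 0 1) :=
    (intervalIntegrable_iff_integrableOn_Ioc_of_le zero_le_one).1
      (intervalIntegral.intervalIntegrable_rpow' he)
  have h2 : IntegrableOn (fun x : ℝ => x ^ (e - 2)) (Set.Ioi 1) :=
    integrableOn_Ioi_rpow_of_lt (by linarith) one_pos
  rw [← Set.Ioc_union_Ioi_eq_Ioi (zero_le_one (α := ℝ)),
    lintegral_union measurableSet_Ioi Set.Ioc_disjoint_Ioi_same]
  refine ENNReal.add_ne_top.2 ⟨ne_top_of_le_ne_top h1.lintegral_lt_top.ne ?_,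
    ne_top_of_le_ne_top h2.lintegral_lt_top.ne ?_⟩
  · refine setLIntegral_mono' measurableSet_Ioc fun x hx => ENNReal.ofReal_le_ofReal ?_
    exact mul_le_of_le_one_left (Real.rpow_nonneg hx.1.le _) (min_le_left _ _)
  · refine setLIntegral_mono' measurableSet_Ioi fun x hx => ENNReal.ofReal_le_ofReal ?_
    have hx0 : 0 < x := lt_trans one_pos hx
    calc decayProfile x * x ^ e ≤ x ^ (-2 : ℝ) * x ^ e := by
          gcongr
          exact min_le_right _ _
      _ = x ^ (e - 2) := by
          rw [← Real.rpow_add hx0]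
          congr 1
          ring

/-- Discrete Hardy inequality adapted to the scales `4 ^ (i + 1)`. -/
theorem exists_lintegral_tsum_decayProfile_rpow_le {p : ℝ} (hp : 1 ≤ p) :
    ∃ C : ℝ≥0∞, C ≠ ⊤ ∧ ∀ a : ℕ → ℝ≥0∞,
      ∫⁻ t in Set.Ioi 0,
          (∑' i : ℕ, ENNReal.ofReal (decayProfile (t * 4 ^ (i + 1))) * a i) ^ p ≤
        C * ∑' i : ℕ, (ENNReal.ofReal ((2 : ℝ) ^ (-2 / p * ((i : ℝ) + 1))) * a i) ^ p := by
  have hp0 : 0 < p := by linarith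
  have hδ : 0 < 1 / p := by positivity
  have hδ1 : 1 / p ≤ 1 := by rw [div_le_one hp0]; exact hp
  obtain ⟨C₁, hC₁, hsum⟩ := exists_tsum_decayProfile_le hδ (by linarith)
  set v : ℝ → ℝ≥0∞ := fun x => ENNReal.ofReal (decayProfile x * x ^ (1 / p - 1)) with hv
  have hvm : Measurable v := by fun_prop
  set C₂ := ∫⁻ x in Set.Ioi 0, v x with hC₂
  have hC₂' : C₂ ≠ ⊤ := lintegral_decayProfile_rpow_ne_top (by linarith) (by linarith)
  refine ⟨C₁ ^ (p - 1) * C₂, ENNReal.mul_ne_top (ENNReal.rpow_ne_top_of_nonneg (by linarith) hC₁)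
    hC₂', fun a => ?_⟩
  have hpt : ∀ t ∈ Set.Ioi (0 : ℝ),
      (∑' i : ℕ, ENNReal.ofReal (decayProfile (t * 4 ^ (i + 1))) * a i) ^ p ≤
        C₁ ^ (p - 1) * ∑' i : ℕ, v (4 ^ (i + 1) * t) * a i ^ p := by
    intro t ht
    have ht0 : 0 < t := ht
    have h := lintegral_mul_rpow_le (Measure.count (α := ℕ)) hp
      (w := fun i => ENNReal.ofReal (decayProfile (t * 4 ^ (i + 1)) * (t * 4 ^ (i + 1)) ^ (1 / p)))
      (c := fun i => ENNReal.ofReal ((t * 4 ^ (i + 1)) ^ (-(1 / p))) * a i)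
      (measurable_from_nat) (measurable_from_nat)
    simp only [lintegral_count] at h
    refine le_trans (le_of_eq ?_) (h.trans (mul_le_mul' (ENNReal.rpow_le_rpow (hsum t ht0)
      (by linarith)) (le_of_eq ?_)))
    · congr 1
      refine tsum_congr fun i => ?_
      have hx : 0 < t * 4 ^ (i + 1) := by positivity
      rw [← mul_assoc, ← ENNReal.ofReal_mul (mul_nonneg (decayProfile_nonneg hx.le)
        (by positivity)), mul_assoc, ← Real.rpow_add hx, add_neg_cancel, Real.rpow_zero, mul_one]
    · refine tsum_congr fun i => ?_
      have hx : 0 < t * 4 ^ (i + 1) := by positivity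
      rw [ENNReal.mul_rpow_of_nonneg _ _ hp0.le, ENNReal.ofReal_rpow_of_nonneg (by positivity) hp0.le,
        ← mul_assoc, ← ENNReal.ofReal_mul (mul_nonneg (decayProfile_nonneg hx.le)
        (by positivity)), mul_assoc, ← Real.rpow_mul hx.le, ← Real.rpow_add hx, hv, mul_comm _ t]
      congr 5
      field_simp
  calc _ ≤ ∫⁻ t in Set.Ioi 0, C₁ ^ (p - 1) * ∑' i : ℕ, v (4 ^ (i + 1) * t) * a i ^ p :=
        setLIntegral_mono' measurableSet_Ioi hpt
    _ = C₁ ^ (p - 1) * ∑' i : ℕ, ∫⁻ t in Set.Ioi 0, v (4 ^ (i + 1) * t) * a i ^ p := by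
        rw [lintegral_const_mul _ (by fun_prop), lintegral_tsum (fun i => by fun_prop)]
    _ = C₁ ^ (p - 1) * ∑' i : ℕ, C₂ *
          (ENNReal.ofReal ((2 : ℝ) ^ (-2 / p * ((i : ℝ) + 1))) * a i) ^ p := by
        congr 1
        refine tsum_congr fun i => ?_
        rw [lintegral_mul_const _ (by fun_prop), lintegral_Ioi_comp_mul hvm (by positivity),
          ← hC₂, ENNReal.mul_rpow_of_nonneg _ _ hp0.le,
          ENNReal.ofReal_rpow_of_nonneg (by positivity) hp0.le, ← Real.rpow_mul (by norm_num),
          mul_comm (ENNReal.ofReal _) C₂, mul_assoc]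
        congr 3
        rw [show (4 : ℝ) = 2 ^ (2 : ℝ) by norm_num, ← Real.rpow_natCast, ← Real.rpow_mul
          (by norm_num), ← Real.rpow_neg (by norm_num)]
        congr 1
        push_cast
        field_simp
    _ = _ := by rw [ENNReal.tsum_mul_left, mul_assoc]

section FourierMultipliers

open FourierTransform SchwartzMap Filter Topology

theorem exp_neg_mul_sq_decay {b : ℝ} (hb : 1 ≤ b) (N : ℕ) {r : ℝ} (hr : 0 ≤ r) :
    (1 + r) ^ N * Real.exp (-b * r ^ 2) ≤ N.factorial * Real.exp 2 := by
  have h1 : (1 + r) ^ N ≤ N.factorial * Real.exp (1 + r) := by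
    have := Real.pow_div_factorial_le_exp (1 + r) (by linarith) N
    rwa [div_le_iff₀ (by positivity), mul_comm] at this
  calc (1 + r) ^ N * Real.exp (-b * r ^ 2)
      ≤ N.factorial * Real.exp (1 + r) * Real.exp (-b * r ^ 2) := by gcongr
    _ = N.factorial * Real.exp (1 + r + -b * r ^ 2) := by rw [mul_assoc, ← Real.exp_add]
    _ ≤ _ := by
        gcongr
        nlinarith [sq_nonneg r, sq_nonneg (r - 1)]

/-- The Gaussian `exp (-b |x|²)` as a real Schwartz function. -/
def gaussianSchwartzReal (n : ℕ) {b : ℝ} (hb : 1 ≤ b) : SchwartzMap (Rn n) ℝ where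
  toFun x := Real.exp (-b * ‖x‖ ^ 2)
  smooth' := Real.contDiff_exp.comp (contDiff_const.mul (contDiff_norm_sq ℝ))
  decay' k m := by
    have hq : Function.HasTemperateGrowth (fun x : Rn n => -b * ‖x‖ ^ 2) :=
      (Function.HasTemperateGrowth.const (-b)).mul (Function.hasTemperateGrowth_norm_sq (Rn n))
    obtain ⟨l, C, hC, h⟩ := hq.norm_iteratedFDeriv_le_uniform m
    refine ⟨m.factorial * (C + 1) ^ m * ((k + l * m).factorial * Real.exp 2), fun x => ?_⟩
    set r := ‖x‖ with hr
    have hr0 : 0 ≤ r := norm_nonneg x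
    have hD1 : 1 ≤ (C + 1) * (1 + r) ^ l :=
      one_le_mul_of_one_le_of_one_le (by linarith) (one_le_pow₀ (by linarith))
    have key := norm_iteratedFDeriv_comp_le (𝕜 := ℝ) (g := Real.exp) (n := m) (N := m)
      (Real.contDiff_exp) (hq.1.of_le (mod_cast le_top)) le_rfl x
      (C := Real.exp (-b * r ^ 2)) (D := (C + 1) * (1 + r) ^ l)
      (fun i _ => by
        rw [norm_iteratedFDeriv_eq_norm_iteratedDeriv, iteratedDeriv_eq_iterate,
          Real.iter_deriv_exp, Real.norm_eq_abs, Real.abs_exp])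
      (fun i hi1 him => by
        refine (h i him x).trans (le_trans ?_ (le_self_pow₀ hD1 (by omega)))
        gcongr
        linarith)
    calc r ^ k * ‖iteratedFDeriv ℝ m (fun x : Rn n => Real.exp (-b * ‖x‖ ^ 2)) x‖
        ≤ (1 + r) ^ k * (m.factorial * Real.exp (-b * r ^ 2) * ((C + 1) * (1 + r) ^ l) ^ m) := by
          gcongr
          · linarith
          · exact key
      _ = m.factorial * (C + 1) ^ m * ((1 + r) ^ (k + l * m) * Real.exp (-b * r ^ 2)) := by
          rw [mul_pow, ← pow_mul, pow_add]
          ring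
      _ ≤ _ := by
          exact mul_le_mul_of_nonneg_left (exp_neg_mul_sq_decay hb _ hr0) (by positivity)

/-- The heat symbol `exp (-4π²|ξ|²)` as a Schwartz function. -/
def heatSymbol (n : ℕ) : SchwartzMap (Rn n) ℂ :=
  postcompCLM (𝕜 := ℝ) Complex.ofRealCLM
    (gaussianSchwartzReal n (b := 4 * π ^ 2) (by nlinarith [Real.pi_gt_three]))

theorem heatSymbol_apply {n : ℕ} (ξ : Rn n) :
    heatSymbol n ξ = (Real.exp (-(4 * π ^ 2) * ‖ξ‖ ^ 2) : ℝ) := rfl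

/-- Pointwise product of Schwartz functions. -/
def schwartzMul {n : ℕ} (m g : SchwartzMap (Rn n) ℂ) : SchwartzMap (Rn n) ℂ :=
  SchwartzMap.pairing (ContinuousLinearMap.mul ℂ ℂ) m g

@[simp]
theorem schwartzMul_apply {n : ℕ} (m g : SchwartzMap (Rn n) ℂ) (x : Rn n) :
    schwartzMul m g x = m x * g x := rfl

/-- The dilation `m ↦ m (c ·)` of a Schwartz function, for `c ≠ 0`. -/
def schwartzDil {n : ℕ} (c : ℝ) (hc : c ≠ 0) (m : SchwartzMap (Rn n) ℂ) : SchwartzMap (Rn n) ℂ :=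
  compCLMOfContinuousLinearEquiv ℂ
    (ContinuousLinearEquiv.smulLeft (Units.mk0 c hc) : Rn n ≃L[ℝ] Rn n) m

@[simp]
theorem schwartzDil_apply {n : ℕ} (c : ℝ) (hc : c ≠ 0) (m : SchwartzMap (Rn n) ℂ) (x : Rn n) :
    schwartzDil c hc m x = m (c • x) := rfl

/-- The Fourier multiplier operator with Schwartz symbol `m`. -/
def schwartzMultiplier {n : ℕ} (m f : SchwartzMap (Rn n) ℂ) : SchwartzMap (Rn n) ℂ :=
  𝓕⁻ (schwartzMul m (𝓕 f))

theorem schwartzMultiplier_apply_eq_integral {n : ℕ} (m f : SchwartzMap (Rn n) ℂ) (x : Rn n) :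
    schwartzMultiplier m f x = ∫ y, (𝓕⁻ m) y * f (x - y) := by
  have h : schwartzMultiplier m f =
      SchwartzMap.convolution (ContinuousLinearMap.mul ℂ ℂ) (𝓕⁻ m) f := by
    simp [schwartzMultiplier, SchwartzMap.convolution, schwartzMul]
  rw [h, SchwartzMap.convolution_apply]
  rfl

theorem eLpNorm_schwartzMultiplier_le {n : ℕ} {p : ℝ} (hp : 1 ≤ p)
    (m f : SchwartzMap (Rn n) ℂ) :
    eLpNorm (schwartzMultiplier m f) (ENNReal.ofReal p) volume ≤
      eLpNorm (𝓕⁻ m : SchwartzMap (Rn n) ℂ) 1 volume * eLpNorm f (ENNReal.ofReal p) volume := by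
  rw [show ⇑(schwartzMultiplier m f) = fun x => ∫ y, (𝓕⁻ m) y * f (x - y) from
    funext fun x => schwartzMultiplier_apply_eq_integral m f x]
  exact eLpNorm_conv_le hp (𝓕⁻ m).continuous.measurable f.continuous.measurable

theorem schwartzMultiplier_comp {n : ℕ} (m m' f : SchwartzMap (Rn n) ℂ) :
    schwartzMultiplier m (schwartzMultiplier m' f) =
      schwartzMultiplier (schwartzMul m m') f := by
  unfold schwartzMultiplier
  rw [FourierTransform.fourier_fourierInv_eq]
  congr 1
  ext x
  simp [mul_assoc]

theorem schwartzMultiplier_smul {n : ℕ} (c : ℂ) (m f : SchwartzMap (Rn n) ℂ) :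
    schwartzMultiplier (c • m) f = c • schwartzMultiplier m f := by
  unfold schwartzMultiplier
  rw [← FourierTransform.fourierInv_smul]
  congr 1
  ext x
  simp [mul_assoc]

theorem schwartzMultiplier_add {n : ℕ} (m m' f : SchwartzMap (Rn n) ℂ) :
    schwartzMultiplier (m + m') f = schwartzMultiplier m f + schwartzMultiplier m' f := by
  unfold schwartzMultiplier
  rw [← FourierTransform.fourierInv_add]
  congr 1
  ext x
  simp [add_mul]

theorem schwartzMultiplier_add_right {n : ℕ} (m f g : SchwartzMap (Rn n) ℂ) :
    schwartzMultiplier m (f + g) = schwartzMultiplier m f + schwartzMultiplier m g := by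
  unfold schwartzMultiplier
  rw [FourierTransform.fourier_add, ← FourierTransform.fourierInv_add]
  congr 1
  ext x
  simp [mul_add]

theorem fourierInv_schwartzDil {n : ℕ} {c : ℝ} (hc : 0 < c) (m : SchwartzMap (Rn n) ℂ)
    (x : Rn n) :
    (𝓕⁻ (schwartzDil c hc.ne' m)) x = (((c ^ n)⁻¹ : ℝ) : ℂ) * (𝓕⁻ m) (c⁻¹ • x) := by
  rw [SchwartzMap.fourierInv_coe, SchwartzMap.fourierInv_coe, Real.fourierInv_eq',
    Real.fourierInv_eq']
  have h := Measure.integral_comp_smul (volume : Measure (Rn n))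
    (fun v => Complex.exp (((2 * π * inner ℝ v (c⁻¹ • x) : ℝ) : ℂ) * Complex.I) • m v) c
  rw [finrank_euclideanSpace, Fintype.card_fin, abs_of_pos (by positivity),
    Complex.real_smul] at h
  rw [← h]
  refine integral_congr_ae (Eventually.of_forall fun v => ?_)
  simp [inner_smul_left, inner_smul_right, hc.ne']

theorem eLpNorm_fourierInv_schwartzDil {n : ℕ} {c : ℝ} (hc : 0 < c) (m : SchwartzMap (Rn n) ℂ) :
    eLpNorm (𝓕⁻ (schwartzDil c hc.ne' m) : SchwartzMap (Rn n) ℂ) 1 volume =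
      eLpNorm (𝓕⁻ m : SchwartzMap (Rn n) ℂ) 1 volume := by
  rw [eLpNorm_one_eq_lintegral_enorm, eLpNorm_one_eq_lintegral_enorm]
  simp_rw [fourierInv_schwartzDil hc, enorm_mul]
  have hm : Measurable fun x => ‖(𝓕⁻ m : SchwartzMap (Rn n) ℂ) x‖ₑ :=
    (𝓕⁻ m : SchwartzMap (Rn n) ℂ).continuous.measurable.enorm
  have hcn : (0 : ℝ) < c ^ n := by positivity
  have hm2 : Measurable fun x : Rn n => ‖(𝓕⁻ m : SchwartzMap (Rn n) ℂ) (c⁻¹ • x)‖ₑ :=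
    hm.comp (measurable_const_smul _)
  rw [lintegral_const_mul _ hm2, lintegral_comp_smul hm (inv_pos.2 hc), ← mul_assoc, inv_pow,
    inv_inv, ← ofReal_norm,
    Complex.norm_real, Real.norm_of_nonneg (by positivity), ← ENNReal.ofReal_mul (by positivity),
    inv_mul_cancel₀ hcn.ne', ENNReal.ofReal_one, one_mul]

theorem fourierInv_heatSymbol {n : ℕ} {t : ℝ} (ht : 0 < t) (x : Rn n) :
    (𝓕⁻ (schwartzDil (√t) (Real.sqrt_pos.2 ht).ne' (heatSymbol n))) x =
      ((heatKer n x t : ℝ) : ℂ) := by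
  have hf : ⇑(schwartzDil (√t) (Real.sqrt_pos.2 ht).ne' (heatSymbol n)) =
      fun v : Rn n => Complex.exp (-((4 * π ^ 2 * t : ℝ) : ℂ) * ‖v‖ ^ 2) := by
    ext v
    rw [schwartzDil_apply, heatSymbol_apply, norm_smul, mul_pow, Real.norm_eq_abs, sq_abs,
      Real.sq_sqrt ht.le]
    push_cast
    congr 1
    ring
  rw [SchwartzMap.fourierInv_coe, Real.fourierInv_eq_fourier_neg, hf,
    fourier_gaussian_innerProductSpace (by rw [Complex.ofReal_re]; positivity),
    heatKer, if_pos ht, norm_neg, finrank_euclideanSpace, Fintype.card_fin]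
  have h1 : (π : ℂ) / ((4 * π ^ 2 * t : ℝ) : ℂ) = (((4 * π * t)⁻¹ : ℝ) : ℂ) := by
    push_cast
    field_simp
  rw [h1, Complex.ofReal_mul (_ ^ _), Complex.ofReal_exp]
  congr 1
  · rw [show ((n : ℂ) / 2) = (((n : ℝ) / 2 : ℝ) : ℂ) by push_cast; rfl,
      ← Complex.ofReal_cpow (by positivity), Real.inv_rpow (by positivity),
      ← Real.rpow_neg (by positivity), neg_div]
  · congr 1
    push_cast
    field_simp

theorem heatExt_eq_schwartzMultiplier {n : ℕ} {t : ℝ} (ht : 0 < t) (f : SchwartzMap (Rn n) ℂ)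
    (x : Rn n) :
    heatExt f (x, t) =
      schwartzMultiplier (schwartzDil (√t) (Real.sqrt_pos.2 ht).ne' (heatSymbol n)) f x := by
  rw [schwartzMultiplier_apply_eq_integral, heatExt, ← integral_sub_left_eq_self _ volume x]
  refine integral_congr_ae (Eventually.of_forall fun y => ?_)
  simp only [fourierInv_heatSymbol ht, sub_sub_cancel]

theorem convn_eq_schwartzMultiplier {n : ℕ} {g : Rn n → ℂ} {m : SchwartzMap (Rn n) ℂ}
    (hg : ∀ x, g x = (𝓕⁻ m) x) (f : SchwartzMap (Rn n) ℂ) :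
    convn g f = schwartzMultiplier m f := by
  ext x
  rw [schwartzMultiplier_apply_eq_integral, convn, ← integral_sub_left_eq_self _ volume x]
  refine integral_congr_ae (Eventually.of_forall fun y => ?_)
  simp only [hg, sub_sub_cancel]

theorem FTn_eq_fourier {n : ℕ} (f : SchwartzMap (Rn n) ℂ) (ξ : Rn n) : FTn f ξ = (𝓕 f) ξ := by
  rw [SchwartzMap.fourier_coe, Real.fourier_eq', FTn]
  refine integral_congr_ae (Eventually.of_forall fun x => ?_)
  simp only [smul_eq_mul]
  congr 2
  rw [PiLp.inner_apply]
  simp only [RCLike.inner_apply, conj_trivial]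
  push_cast
  simp_rw [mul_comm (ξ.ofLp _ : ℂ)]
  ring

end FourierMultipliers

section LittlewoodPaley

open FourierTransform SchwartzMap Filter Topology

/-- A Schwartz function equal to `|ξ|⁻⁴` on the annulus `1/2 < |ξ| < 2`. -/
theorem exists_schwartz_eq_inv_norm_pow_four (n : ℕ) :
    ∃ E : SchwartzMap (Rn n) ℂ, ∀ ξ : Rn n, 1 / 2 < ‖ξ‖ → ‖ξ‖ < 2 →
      E ξ * ((‖ξ‖ ^ 4 : ℝ) : ℂ) = 1 := by
  let b₁ : ContDiffBump (0 : Rn n) := ⟨2, 3, by norm_num, by norm_num⟩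
  let b₂ : ContDiffBump (0 : Rn n) := ⟨1 / 4, 1 / 2, by norm_num, by norm_num⟩
  have hden : ∀ ξ : Rn n, ‖ξ‖ ^ 4 + b₂ ξ ≠ 0 := fun ξ => by
    rcases eq_or_ne ξ 0 with rfl | h
    · have : b₂ (0 : Rn n) = 1 := b₂.one_of_mem_closedBall (by simp [b₂])
      simp [this]
    · have h1 : 0 < ‖ξ‖ := norm_pos_iff.2 h
      have h2 : 0 ≤ b₂ ξ := b₂.nonneg
      positivity
  have hsmooth : ContDiff ℝ ((⊤ : ℕ∞) : WithTop ℕ∞) fun ξ : Rn n => b₁ ξ / (‖ξ‖ ^ 4 + b₂ ξ) := by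
    refine b₁.contDiff.div (ContDiff.add ?_ b₂.contDiff) hden
    have h := (contDiff_norm_sq (E := Rn n) ℝ (n := ((⊤ : ℕ∞) : WithTop ℕ∞))).pow 2
    simpa [← pow_mul] using h
  have hcpt : HasCompactSupport fun ξ : Rn n => b₁ ξ / (‖ξ‖ ^ 4 + b₂ ξ) := by
    simp_rw [div_eq_mul_inv]
    exact b₁.hasCompactSupport.mul_right
  refine ⟨postcompCLM (𝕜 := ℝ) Complex.ofRealCLM (hcpt.toSchwartzMap hsmooth),
    fun ξ h1 h2 => ?_⟩
  have e1 : b₁ ξ = 1 := b₁.one_of_mem_closedBall (by simpa [b₁] using h2.le)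
  have e2 : b₂ ξ = 0 := b₂.zero_of_le_dist (by simpa [b₂] using h1.le)
  change ((b₁ ξ / (‖ξ‖ ^ 4 + b₂ ξ) : ℝ) : ℂ) * _ = 1
  have h3 : ‖ξ‖ ≠ 0 := by linarith
  rw [e1, e2, add_zero, ← Complex.ofReal_mul, one_div, inv_mul_cancel₀ (pow_ne_zero _ h3),
    Complex.ofReal_one]

/-- There is a Schwartz function equal to `|ξ|⁴ exp (-4π²|ξ|²)`. -/
theorem exists_schwartz_eq_norm_pow_four_mul_heatSymbol (n : ℕ) :
    ∃ G : SchwartzMap (Rn n) ℂ, ∀ ξ : Rn n,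
      G ξ = ((‖ξ‖ ^ 4 : ℝ) : ℂ) * heatSymbol n ξ := by
  have hg : Function.HasTemperateGrowth fun ξ : Rn n => ‖ξ‖ ^ 2 :=
    Function.hasTemperateGrowth_norm_sq (Rn n)
  refine ⟨smulLeftCLM ℂ (fun ξ : Rn n => ‖ξ‖ ^ 2)
    (smulLeftCLM ℂ (fun ξ : Rn n => ‖ξ‖ ^ 2) (heatSymbol n)), fun ξ => ?_⟩
  rw [smulLeftCLM_apply_apply hg, smulLeftCLM_apply_apply hg, smul_smul, ← pow_add,
    Complex.real_smul]

theorem exists_eLpNorm_heat_block_le {n : ℕ} (Φ : SchwartzMap (Rn n) ℂ)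
    (hΦ : ∀ ξ, ¬(1 / 2 < ‖ξ‖ ∧ ‖ξ‖ < 2) → Φ ξ = 0) :
    ∃ C : ℝ≥0∞, C ≠ ⊤ ∧ ∀ {p : ℝ}, 1 ≤ p → ∀ {t : ℝ} (ht : 0 < t) {c : ℝ} (hc : 0 < c)
      (f : SchwartzMap (Rn n) ℂ),
      eLpNorm (schwartzMultiplier (schwartzDil (√t) (Real.sqrt_pos.2 ht).ne' (heatSymbol n))
          (schwartzMultiplier (schwartzDil c hc.ne' Φ) f)) (ENNReal.ofReal p) volume ≤
        C * (ENNReal.ofReal (decayProfile (t * c⁻¹ ^ 2)) *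
          eLpNorm (schwartzMultiplier (schwartzDil c hc.ne' Φ) f) (ENNReal.ofReal p) volume) := by
  obtain ⟨E, hE⟩ := exists_schwartz_eq_inv_norm_pow_four n
  obtain ⟨G, hG⟩ := exists_schwartz_eq_norm_pow_four_mul_heatSymbol n
  set C₀ := eLpNorm (𝓕⁻ (heatSymbol n) : SchwartzMap (Rn n) ℂ) 1 volume with hC₀
  set C₁ := eLpNorm (𝓕⁻ G : SchwartzMap (Rn n) ℂ) 1 volume with hC₁
  set C₂ := eLpNorm (𝓕⁻ E : SchwartzMap (Rn n) ℂ) 1 volume with hC₂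
  refine ⟨C₀ + C₁ * C₂, ENNReal.add_ne_top.2 ⟨(SchwartzMap.eLpNorm_lt_top _ _ _).ne,
    ENNReal.mul_ne_top (SchwartzMap.eLpNorm_lt_top _ _ _).ne
      (SchwartzMap.eLpNorm_lt_top _ _ _).ne⟩, fun {p} hp {t} ht {c} hc f => ?_⟩
  have hs := Real.sqrt_pos.2 ht
  set g := schwartzMultiplier (schwartzDil c hc.ne' Φ) f with hg
  have hx : 0 < t * c⁻¹ ^ 2 := by positivity
  unfold decayProfile
  rcases min_choice (1 : ℝ) ((t * c⁻¹ ^ 2) ^ (-2 : ℝ)) with h | h <;> rw [h]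
  · rw [ENNReal.ofReal_one, one_mul]
    refine (eLpNorm_schwartzMultiplier_le hp _ _).trans ?_
    rw [eLpNorm_fourierInv_schwartzDil hs]
    gcongr
    exact le_self_add
  · have hk : (t * c⁻¹ ^ 2) ^ (-2 : ℝ) = c ^ 4 / t ^ 2 := by
      rw [Real.rpow_neg hx.le, Real.rpow_ofNat]
      field_simp
    have hsymb : schwartzMul (schwartzDil (√t) hs.ne' (heatSymbol n)) (schwartzDil c hc.ne' Φ) =
        ((c ^ 4 / t ^ 2 : ℝ) : ℂ) • schwartzMul (schwartzDil (√t) hs.ne' G)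
          (schwartzMul (schwartzDil c hc.ne' E) (schwartzDil c hc.ne' Φ)) := by
      ext ξ
      simp only [smul_apply, schwartzMul_apply, schwartzDil_apply, smul_eq_mul, hG]
      by_cases hξ : 1 / 2 < ‖c • ξ‖ ∧ ‖c • ξ‖ < 2
      · have h1 := hE _ hξ.1 hξ.2
        have h2 : ‖c • ξ‖ ^ 4 = c ^ 4 / t ^ 2 * ‖√t • ξ‖ ^ 4 := by
          rw [norm_smul, norm_smul, Real.norm_of_nonneg hc.le, Real.norm_of_nonneg hs.le,
            mul_pow, mul_pow, show √t ^ 4 = t ^ 2 by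
              rw [show 4 = 2 * 2 from rfl, pow_mul, Real.sq_sqrt ht.le]]
          field_simp
        rw [h2, Complex.ofReal_mul] at h1
        linear_combination (-(heatSymbol n (√t • ξ)) * Φ (c • ξ)) * h1
      · simp [hΦ _ hξ]
    have heq : schwartzMultiplier (schwartzDil (√t) hs.ne' (heatSymbol n)) g =
        ((c ^ 4 / t ^ 2 : ℝ) : ℂ) • schwartzMultiplier (schwartzDil (√t) hs.ne' G)
          (schwartzMultiplier (schwartzDil c hc.ne' E) g) := by
      rw [hg, schwartzMultiplier_comp, hsymb, schwartzMultiplier_smul,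
        schwartzMultiplier_comp (schwartzDil c hc.ne' E), schwartzMultiplier_comp]
    rw [heq, hk]
    change eLpNorm (((c ^ 4 / t ^ 2 : ℝ) : ℂ) • ⇑(schwartzMultiplier _ _)) _ _ ≤ _
    rw [eLpNorm_const_smul, ← ofReal_norm, Complex.norm_real,
      Real.norm_of_nonneg (by positivity)]
    calc ENNReal.ofReal (c ^ 4 / t ^ 2) * eLpNorm (schwartzMultiplier (schwartzDil (√t) hs.ne' G)
          (schwartzMultiplier (schwartzDil c hc.ne' E) g)) (ENNReal.ofReal p) volume
        ≤ ENNReal.ofReal (c ^ 4 / t ^ 2) *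
            (C₁ * (C₂ * eLpNorm g (ENNReal.ofReal p) volume)) := by
          gcongr
          refine (eLpNorm_schwartzMultiplier_le hp _ _).trans ?_
          rw [eLpNorm_fourierInv_schwartzDil hs]
          gcongr
          refine (eLpNorm_schwartzMultiplier_le hp _ _).trans ?_
          rw [eLpNorm_fourierInv_schwartzDil hc]
      _ = C₁ * C₂ * (ENNReal.ofReal (c ^ 4 / t ^ 2) * eLpNorm g (ENNReal.ofReal p) volume) := by
          ring
      _ ≤ _ := by
          gcongr
          exact le_add_self

theorem tendsto_schwartzMultiplier_schwartzDil {n : ℕ} {Ψ : SchwartzMap (Rn n) ℂ} (hΨ : Ψ 0 = 1)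
    {c : ℕ → ℝ} (hc : ∀ K, c K ≠ 0) (hc0 : Tendsto c atTop (𝓝 0)) (g : SchwartzMap (Rn n) ℂ)
    (x : Rn n) :
    Tendsto (fun K => schwartzMultiplier (schwartzDil (c K) (hc K) Ψ) g x) atTop (𝓝 (g x)) := by
  have h0 : g x = 𝓕⁻ (⇑(𝓕 g : SchwartzMap (Rn n) ℂ)) x := by
    rw [← SchwartzMap.fourierInv_coe, FourierTransform.fourierInv_fourier_eq]
  rw [h0]
  simp only [schwartzMultiplier, SchwartzMap.fourierInv_coe]
  simp only [Real.fourierInv_eq']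
  refine tendsto_integral_of_dominated_convergence
    (fun ξ => SchwartzMap.seminorm ℝ 0 0 Ψ * ‖(𝓕 g : SchwartzMap (Rn n) ℂ) ξ‖)
    (fun K => ?_) ?_ (fun K => ?_) ?_
  · refine Continuous.aestronglyMeasurable ?_
    have := (schwartzMul (schwartzDil (c K) (hc K) Ψ) (𝓕 g)).continuous
    fun_prop
  · exact ((𝓕 g : SchwartzMap (Rn n) ℂ).integrable.norm).const_mul _
  · refine Eventually.of_forall fun ξ => ?_
    rw [norm_smul, Complex.norm_exp_ofReal_mul_I, one_mul, schwartzMul_apply, norm_mul]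
    gcongr
    exact norm_le_seminorm ℝ Ψ _
  · refine Eventually.of_forall fun ξ => Tendsto.const_smul ?_ _
    simp only [schwartzMul_apply, schwartzDil_apply]
    have h1 : Tendsto (fun K => c K • ξ) atTop (𝓝 0) := by
      simpa using hc0.smul_const ξ
    have h2 := (Ψ.continuous.tendsto 0).comp h1
    rw [hΨ] at h2
    simpa using h2.mul_const ((𝓕 g : SchwartzMap (Rn n) ℂ) ξ)

theorem fourier_apply_eq_zero {n : ℕ} (P : LPFamily n) (ξ : Rn n)
    (h : ¬(1 / 2 < ‖ξ‖ ∧ ‖ξ‖ < 2)) : (𝓕 P.φ) ξ = 0 := by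
  rw [← FTn_eq_fourier]
  exact P.ft_supp ξ h

theorem fourier_psi_apply {n : ℕ} (P : LPFamily n) (ξ : Rn n) :
    (𝓕 P.ψ) ξ = 1 - ∑' i : ℕ, (𝓕 P.φ) (((2 : ℝ) ^ (i + 1))⁻¹ • ξ) := by
  rw [← FTn_eq_fourier, P.ft_psi]
  congr 2
  ext i
  rw [FTn_eq_fourier, zpow_neg]
  norm_cast

theorem fourier_psi_zero {n : ℕ} (P : LPFamily n) : (𝓕 P.ψ) 0 = 1 := by
  simp [fourier_psi_apply, fourier_apply_eq_zero P 0 (by simp)]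

theorem tendsto_inv_two_pow : Tendsto (fun i : ℕ => ((2 : ℝ) ^ i)⁻¹) atTop (𝓝 0) := by
  exact tendsto_inv_atTop_zero.comp
    (tendsto_pow_atTop_atTop_of_one_lt (one_lt_two (α := ℝ)))

theorem summable_fourier_dilates {n : ℕ} (P : LPFamily n) (ξ : Rn n) :
    Summable fun i : ℕ => (𝓕 P.φ) (((2 : ℝ) ^ (i + 1))⁻¹ • ξ) := by
  refine summable_of_hasFiniteSupport (?_ : {i | ¬ _ = _}.Finite)
  rw [← Filter.eventually_cofinite, Nat.cofinite_eq_atTop]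
  have h : Tendsto (fun i : ℕ => ‖((2 : ℝ) ^ (i + 1))⁻¹ • ξ‖) atTop (𝓝 0) := by
    simpa using (((tendsto_add_atTop_iff_nat 1).2 tendsto_inv_two_pow).smul_const ξ).norm
  filter_upwards [h.eventually_lt_const (show (0 : ℝ) < 1 / 2 by norm_num)] with i hi
  exact fourier_apply_eq_zero P _ fun h => by linarith [h.1]

theorem fourier_psi_half_smul {n : ℕ} (P : LPFamily n) (ξ : Rn n) :
    (𝓕 P.ψ) ((2 : ℝ)⁻¹ • ξ) = (𝓕 P.ψ) ξ + (𝓕 P.φ) ((2 : ℝ)⁻¹ • ξ) := by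
  have h := (summable_fourier_dilates P ξ).tsum_eq_zero_add
  rw [fourier_psi_apply, fourier_psi_apply, h]
  have h2 : ∀ i : ℕ, ((2 : ℝ) ^ (i + 1))⁻¹ • (2 : ℝ)⁻¹ • ξ = ((2 : ℝ) ^ (i + 1 + 1))⁻¹ • ξ :=
    fun i => by rw [smul_smul, ← mul_inv, ← pow_succ]
  simp_rw [h2]
  rw [zero_add, pow_one]
  ring

/-- The Fourier transform of the dilate `φ′_i`. -/
def lpSymbol {n : ℕ} (P : LPFamily n) (i : ℕ) : SchwartzMap (Rn n) ℂ :=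
  schwartzDil ((2 : ℝ) ^ i)⁻¹ (by positivity) (𝓕 P.φ)

/-- The symbol `𝓕ψ′(2^{-K} ·)` of the low-frequency projection. -/
def lowSymbol {n : ℕ} (P : LPFamily n) (K : ℕ) : SchwartzMap (Rn n) ℂ :=
  schwartzDil ((2 : ℝ) ^ K)⁻¹ (by positivity) (𝓕 P.ψ)

theorem lowSymbol_zero {n : ℕ} (P : LPFamily n) : lowSymbol P 0 = 𝓕 P.ψ := by
  ext ξ
  simp [lowSymbol]

theorem lowSymbol_succ {n : ℕ} (P : LPFamily n) (K : ℕ) :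
    lowSymbol P (K + 1) = lowSymbol P K + lpSymbol P (K + 1) := by
  ext ξ
  have h := fourier_psi_half_smul P (((2 : ℝ) ^ K)⁻¹ • ξ)
  rw [smul_smul, ← mul_inv, ← pow_succ'] at h
  simpa [lowSymbol, lpSymbol] using h

theorem convn_psi_eq {n : ℕ} (P : LPFamily n) (f : SchwartzMap (Rn n) ℂ) :
    convn P.ψ f = schwartzMultiplier (𝓕 P.ψ) f :=
  convn_eq_schwartzMultiplier (fun x => by rw [FourierTransform.fourierInv_fourier_eq]) f

theorem convn_lpPhin_eq {n : ℕ} (P : LPFamily n) (i : ℕ) (f : SchwartzMap (Rn n) ℂ) :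
    convn (lpPhin P i) f = schwartzMultiplier (lpSymbol P i) f := by
  refine convn_eq_schwartzMultiplier (fun x => ?_) f
  rw [lpSymbol, fourierInv_schwartzDil (by positivity), FourierTransform.fourierInv_fourier_eq,
    lpPhin, inv_inv, inv_pow, inv_inv, pow_mul]

theorem eLpNorm_heat_lowSymbol_le {n : ℕ} (P : LPFamily n) {p : ℝ} (hp : 1 ≤ p)
    (γ f : SchwartzMap (Rn n) ℂ) (K : ℕ) :
    eLpNorm (schwartzMultiplier γ (schwartzMultiplier (lowSymbol P K) f)) (ENNReal.ofReal p)
        volume ≤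
      eLpNorm (schwartzMultiplier γ (schwartzMultiplier (𝓕 P.ψ) f)) (ENNReal.ofReal p) volume +
        ∑ i ∈ Finset.range K, eLpNorm (schwartzMultiplier γ
          (schwartzMultiplier (lpSymbol P (i + 1)) f)) (ENNReal.ofReal p) volume := by
  induction K with
  | zero => simp [lowSymbol_zero]
  | succ K ih =>
    rw [Finset.sum_range_succ, ← add_assoc, lowSymbol_succ, schwartzMultiplier_add,
      schwartzMultiplier_add_right]
    refine (eLpNorm_add_le (SchwartzMap.continuous _).aestronglyMeasurable
      (SchwartzMap.continuous _).aestronglyMeasurable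
      (by simpa using ENNReal.ofReal_le_ofReal hp)).trans ?_
    gcongr

theorem schwartzMultiplier_comm {n : ℕ} (m m' f : SchwartzMap (Rn n) ℂ) :
    schwartzMultiplier m (schwartzMultiplier m' f) =
      schwartzMultiplier m' (schwartzMultiplier m f) := by
  rw [schwartzMultiplier_comp, schwartzMultiplier_comp]
  congr 1
  ext x
  simp [mul_comm]

theorem eLpNorm_schwartzMultiplier_le_tsum {n : ℕ} (P : LPFamily n) {p : ℝ} (hp : 1 ≤ p)
    (γ f : SchwartzMap (Rn n) ℂ) :
    eLpNorm (schwartzMultiplier γ f) (ENNReal.ofReal p) volume ≤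
      eLpNorm (schwartzMultiplier γ (schwartzMultiplier (𝓕 P.ψ) f)) (ENNReal.ofReal p) volume +
        ∑' i : ℕ, eLpNorm (schwartzMultiplier γ
          (schwartzMultiplier (lpSymbol P (i + 1)) f)) (ENNReal.ofReal p) volume := by
  refine Lp.eLpNorm_le_of_ae_tendsto (u := atTop)
    (f := fun K : ℕ => schwartzMultiplier γ (schwartzMultiplier (lowSymbol P K) f))
    (Eventually.of_forall fun K => (eLpNorm_heat_lowSymbol_le P hp γ f K).trans ?_)
    (fun K => (SchwartzMap.continuous _).aestronglyMeasurable)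
    (Eventually.of_forall fun x => ?_)
  · gcongr
    exact ENNReal.sum_le_tsum _
  · simp_rw [schwartzMultiplier_comm γ]
    exact tendsto_schwartzMultiplier_schwartzDil (fourier_psi_zero P) (fun K => by positivity)
      tendsto_inv_two_pow _ x

theorem exists_eLpNorm_heatExt_slice_le {n : ℕ} (P : LPFamily n) :
    ∃ C : ℝ≥0∞, C ≠ ⊤ ∧ ∀ {p : ℝ}, 1 ≤ p → ∀ {t : ℝ}, 0 < t → ∀ f : SchwartzMap (Rn n) ℂ,
      eLpNorm (fun x => heatExt f (x, t)) (ENNReal.ofReal p) volume ≤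
        C * (eLpNorm (convn P.ψ f) (ENNReal.ofReal p) volume +
          ∑' i : ℕ, ENNReal.ofReal (decayProfile (t * 4 ^ (i + 1))) *
            eLpNorm (convn (lpPhin P (i + 1)) f) (ENNReal.ofReal p) volume) := by
  obtain ⟨C, hC, h⟩ := exists_eLpNorm_heat_block_le (𝓕 P.φ) (fourier_apply_eq_zero P)
  refine ⟨eLpNorm (𝓕⁻ (heatSymbol n) : SchwartzMap (Rn n) ℂ) 1 volume + C,
    ENNReal.add_ne_top.2 ⟨(SchwartzMap.eLpNorm_lt_top _ _ _).ne, hC⟩, fun {p} hp {t} ht f => ?_⟩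
  have hs := Real.sqrt_pos.2 ht
  simp_rw [heatExt_eq_schwartzMultiplier ht, convn_psi_eq, convn_lpPhin_eq]
  refine (eLpNorm_schwartzMultiplier_le_tsum P hp _ f).trans ?_
  rw [mul_add]
  gcongr ?_ + ?_
  · refine (eLpNorm_schwartzMultiplier_le hp _ _).trans ?_
    rw [eLpNorm_fourierInv_schwartzDil hs]
    gcongr
    exact le_self_add
  · rw [← ENNReal.tsum_mul_left]
    refine ENNReal.tsum_le_tsum fun i => ?_
    have hi := h hp ht (c := ((2 : ℝ) ^ (i + 1))⁻¹) (by positivity) f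
    rw [inv_inv, ← pow_mul, mul_comm (i + 1) 2, pow_mul,
      show (2 : ℝ) ^ 2 = 4 by norm_num] at hi
    refine hi.trans ?_
    gcongr
    · exact le_add_self
    · exact le_rfl

theorem measurable_heatExt {n : ℕ} {f : Rn n → ℂ} (hf : Measurable f) :
    Measurable (heatExt f) := by
  have h : Measurable fun z : Rn1 n × Rn n =>
      ((heatKer n (z.1.1 - z.2) z.1.2 : ℝ) : ℂ) * f z.2 := by
    refine Measurable.mul (Complex.measurable_ofReal.comp ?_) (hf.comp measurable_snd)
    unfold heatKer
    refine Measurable.ite (measurableSet_lt measurable_const (by fun_prop)) ?_ measurable_const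
    exact Measurable.mul (by fun_prop) (by fun_prop)
  exact h.stronglyMeasurable.integral_prod_right.measurable

theorem eLpNorm_stripMeasure_rpow {n : ℕ} {p T : ℝ} (hp : 1 ≤ p) {u : Rn1 n → ℂ}
    (hu : Measurable u) :
    eLpNorm u (ENNReal.ofReal p) (stripMeasure n (ENNReal.ofReal T)) ^ p =
      ∫⁻ t in Set.Ioo 0 T, eLpNorm (fun x => u (x, t)) (ENNReal.ofReal p) volume ^ p := by
  have hset : {x : Rn1 n | x.2 ∈ tSet (ENNReal.ofReal T)} = Set.univ ×ˢ Set.Ioo 0 T := by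
    ext x
    simp only [tSet, Set.mem_ofPred_eq, Set.mem_prod, Set.mem_univ, true_and, Set.mem_Ioo]
    refine and_congr_right fun h => ?_
    rw [ENNReal.ofReal_lt_ofReal_iff_of_nonneg h.le]
  simp_rw [eLpNorm_ofReal_rpow _ hp]
  rw [stripMeasure, hset, Measure.volume_eq_prod, ← Measure.prod_restrict,
    Measure.restrict_univ, lintegral_prod_symm _ (by fun_prop)]

end LittlewoodPaley

/-- `‖u‖_{Lᵖ(ℝⁿ×(0,T))} ≲ B_{−2/p,p}(f)` for the heat extension `u` of `f`. -/
theorem stmt14 (n : ℕ) (hn : 1 ≤ n) (p : ℝ) (hp : 1 ≤ p) (T : ℝ) (hT : 0 < T)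
    (P : LPFamily n) :
    ∃ C : ℝ, 0 < C ∧
      ∀ f : SchwartzMap (Rn n) ℂ,
        eLpNorm (heatExt ⇑f) (ENNReal.ofReal p) (stripMeasure n (ENNReal.ofReal T))
          ≤ ENNReal.ofReal C * besovN P (-2 / p) p ⇑f := by
  obtain ⟨C, hC, hslice⟩ := exists_eLpNorm_heatExt_slice_le P
  obtain ⟨D, hD, hsum⟩ := exists_lintegral_tsum_decayProfile_rpow_le hp
  have hp0 : 0 < p := by linarith
  have hp0' : 0 ≤ 1 / p := by positivity
  set M : ℝ≥0∞ := C * (ENNReal.ofReal T ^ (1 / p) + D ^ (1 / p)) with hM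
  have hMtop : M ≠ ⊤ := ENNReal.mul_ne_top hC (ENNReal.add_ne_top.2
    ⟨ENNReal.rpow_ne_top_of_nonneg hp0' ENNReal.ofReal_ne_top,
      ENNReal.rpow_ne_top_of_nonneg hp0' hD⟩)
  refine ⟨M.toReal + 1, by positivity, fun f => ?_⟩
  have hMle : M ≤ ENNReal.ofReal (M.toReal + 1) := by
    rw [ENNReal.le_ofReal_iff_toReal_le hMtop (by positivity)]
    linarith
  refine le_trans ?_ (mul_le_mul_left hMle _)
  set A := eLpNorm (convn P.ψ f) (ENNReal.ofReal p) volume with hA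
  set a : ℕ → ℝ≥0∞ := fun i => eLpNorm (convn (lpPhin P (i + 1)) f) (ENNReal.ofReal p) volume
  set S : ℝ → ℝ≥0∞ := fun t => ∑' i : ℕ, ENNReal.ofReal (decayProfile (t * 4 ^ (i + 1))) * a i
    with hS
  have hSm : Measurable S := by
    refine Measurable.tsum fun i => ?_
    fun_prop
  have hroot : ∀ x : ℝ≥0∞, (x ^ p) ^ (1 / p) = x := fun x => by
    rw [← ENNReal.rpow_mul, mul_one_div_cancel hp0.ne', ENNReal.rpow_one]
  rw [← hroot (eLpNorm _ _ _),
    eLpNorm_stripMeasure_rpow hp (measurable_heatExt f.continuous.measurable)]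
  calc (∫⁻ t in Set.Ioo 0 T,
        eLpNorm (fun x => heatExt f (x, t)) (ENNReal.ofReal p) volume ^ p) ^ (1 / p)
      ≤ (∫⁻ t in Set.Ioo 0 T, (C * (A + S t)) ^ p) ^ (1 / p) := by
        refine ENNReal.rpow_le_rpow (setLIntegral_mono' measurableSet_Ioo fun t ht => ?_) hp0'
        exact ENNReal.rpow_le_rpow (hslice hp ht.1 f) hp0.le
    _ = C * (∫⁻ t in Set.Ioo 0 T, ((fun _ : ℝ => A) + S) t ^ p) ^ (1 / p) := by
        simp_rw [ENNReal.mul_rpow_of_nonneg _ _ hp0.le]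
        rw [lintegral_const_mul _ (by fun_prop), ENNReal.mul_rpow_of_nonneg _ _ hp0', hroot]
        rfl
    _ ≤ C * ((∫⁻ _ in Set.Ioo 0 T, A ^ p) ^ (1 / p) +
          (∫⁻ t in Set.Ioo 0 T, S t ^ p) ^ (1 / p)) := by
        gcongr
        exact ENNReal.lintegral_Lp_add_le aemeasurable_const hSm.aemeasurable hp
    _ ≤ C * (A * ENNReal.ofReal T ^ (1 / p) + (D * ∑' i : ℕ,
          (ENNReal.ofReal ((2 : ℝ) ^ (-2 / p * ((i : ℝ) + 1))) * a i) ^ p) ^ (1 / p)) := by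
        gcongr
        · rw [lintegral_const, Measure.restrict_apply_univ, Real.volume_Ioo, sub_zero,
            ENNReal.mul_rpow_of_nonneg _ _ hp0', hroot]
        · exact (lintegral_mono_set Set.Ioo_subset_Ioi_self).trans (hsum a)
    _ ≤ M * besovN P (-2 / p) p f := by
        rw [ENNReal.mul_rpow_of_nonneg _ _ hp0', hM, besovN, mul_assoc, mul_comm A,
          add_mul]
        gcongr
        · exact le_self_add
        · exact le_add_self
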